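/- (Curve-norm derivative property.) Let r : ℝ → ℝⁿ be differentiable at t ∈ ℝ with derivative r'(t). Then the upper Dini derivative of the squared ℓ∞ norm along the curve satisfies (1/2)·limsup_{h→0⁺} (‖r(t+h)‖∞² − ‖r(t)‖∞²)/h = ⟦r'(t), r(t)⟧∞. -/

import Mathlib

open Filter

/-- The ℓ∞ weak pairing `⟦x,y⟧∞ = max_{i ∈ I∞(y)} y_i x_i`, where
`I∞(y) = {i : |y_i| = ‖y‖∞}`. -/
noncomputable def wpInf {n : ℕ} (x y : Fin n → ℝ) : ℝ :=
  sSup {r | ∃ i, |y i| = ‖y‖ ∧ r = y i * x i}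

/-- In `ℓ∞` on a nonempty finite index set, the norm is attained at some coordinate. -/
theorem exists_abs_eq_pi_norm {ι : Type*} [Fintype ι] [Nonempty ι] (y : ι → ℝ) :
    ∃ i, |y i| = ‖y‖ := by
  obtain ⟨i, hi⟩ := Finite.exists_max fun i => |y i|
  exact ⟨i, le_antisymm (norm_le_pi_norm y i) ((pi_norm_le_iff_of_nonempty y).2 hi)⟩

/-- The weak pairing is the maximum of `y i * x i` over the coordinates attaining the norm. -/
theorem isGreatest_wpInf {n : ℕ} [Nonempty (Fin n)] (x y : Fin n → ℝ) :
    IsGreatest {r | ∃ i, |y i| = ‖y‖ ∧ r = y i * x i} (wpInf x y) := by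
  have hfin : {r | ∃ i, |y i| = ‖y‖ ∧ r = y i * x i}.Finite :=
    (Set.finite_range fun i => y i * x i).subset (by rintro _ ⟨i, -, rfl⟩; exact ⟨i, rfl⟩)
  obtain ⟨i, hi⟩ := exists_abs_eq_pi_norm y
  have hne : {r | ∃ i, |y i| = ‖y‖ ∧ r = y i * x i}.Nonempty := ⟨_, i, hi, rfl⟩
  exact ⟨hne.csSup_mem hfin, fun _ h => le_csSup hfin.bddAbove h⟩

/-- The squared `ℓ∞` norm along a differentiable curve has a right derivative, given by the
weak pairing. -/
theorem tendsto_sq_norm_slope_right {n : ℕ} [Nonempty (Fin n)] (r : ℝ → (Fin n → ℝ)) (t : ℝ)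
    (r' : Fin n → ℝ) (hr : HasDerivAt r r' t) :
    Tendsto (fun h : ℝ => (‖r (t + h)‖ ^ 2 - ‖r t‖ ^ 2) / h) (nhdsWithin 0 (Set.Ioi 0))
      (nhds (2 * wpInf r' (r t))) := by
  obtain ⟨⟨i₀, hi₀, hW⟩, hub⟩ := isGreatest_wpInf r' (r t)
  have hderiv (i : Fin n) : HasDerivAt (fun s => r s i ^ 2) (2 * (r t i * r' i)) t := by
    have h := (hasDerivAt_pi.1 hr i).pow 2
    refine h.congr_deriv ?_
    norm_num
    ring
  have hslope (i : Fin n) : Tendsto (fun h : ℝ => (r (t + h) i ^ 2 - r t i ^ 2) / h)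
      (nhdsWithin 0 (Set.Ioi 0)) (nhds (2 * (r t i * r' i))) := by
    simpa [div_eq_inv_mul] using (hderiv i).tendsto_slope_zero_right
  have hsq {i : Fin n} (hi : |r t i| = ‖r t‖) : r t i ^ 2 = ‖r t‖ ^ 2 := by
    rw [← hi, sq_abs]
  have hpos : ∀ᶠ h : ℝ in nhdsWithin 0 (Set.Ioi 0), 0 < h := self_mem_nhdsWithin
  refine tendsto_order.2 ⟨fun a ha => ?_, fun a ha => ?_⟩
  · rw [hW] at ha
    filter_upwards [(hslope i₀).eventually_const_lt ha, hpos] with h hh hh0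
    refine hh.trans_le ?_
    rw [hsq hi₀]
    have : r (t + h) i₀ ^ 2 ≤ ‖r (t + h)‖ ^ 2 := by
      rw [← sq_abs]
      exact pow_le_pow_left₀ (abs_nonneg _) (norm_le_pi_norm (r (t + h)) i₀) 2
    gcongr
  · have hcoord (i : Fin n) : ∀ᶠ h : ℝ in nhdsWithin 0 (Set.Ioi 0),
        r (t + h) i ^ 2 < ‖r t‖ ^ 2 + a * h := by
      by_cases hi : |r t i| = ‖r t‖
      · have hia : 2 * (r t i * r' i) < a :=
          lt_of_le_of_lt (by linarith [hub ⟨i, hi, rfl⟩]) ha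
        filter_upwards [(hslope i).eventually_lt_const hia, hpos] with h hh hh0
        rw [div_lt_iff₀ hh0, hsq hi] at hh
        linarith
      · have hlt : r t i ^ 2 < ‖r t‖ ^ 2 := by
          rw [← sq_abs]
          exact pow_lt_pow_left₀ (lt_of_le_of_ne (norm_le_pi_norm (r t) i) hi) (abs_nonneg _)
            two_ne_zero
        have hadd : Tendsto (fun h : ℝ => t + h) (nhds 0) (nhds t) := by
          simpa using (continuous_const_add t).tendsto 0
        have h1 : Tendsto (fun h : ℝ => r (t + h) i ^ 2) (nhds 0) (nhds (r t i ^ 2)) :=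
          (hderiv i).continuousAt.tendsto.comp hadd
        have h2 : Tendsto (fun h : ℝ => ‖r t‖ ^ 2 + a * h) (nhds 0) (nhds (‖r t‖ ^ 2)) := by
          have hc : Continuous fun h : ℝ => ‖r t‖ ^ 2 + a * h := by fun_prop
          simpa using hc.tendsto 0
        exact (h1.eventually_lt h2 hlt).filter_mono nhdsWithin_le_nhds
    filter_upwards [eventually_all.2 hcoord, hpos] with h hh hh0
    obtain ⟨j, hj⟩ := exists_abs_eq_pi_norm (r (t + h))
    rw [div_lt_iff₀ hh0, ← hj, sq_abs]
    linarith [hh j]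

/-- Curve-norm derivative property: if `r` is differentiable at `t`, then
`(1/2) D⁺(‖r(t)‖∞²) = ⟦r'(t), r(t)⟧∞`, where `D⁺` is the upper Dini derivative. -/
theorem half_dini_sq_norm_eq_wpInf {n : ℕ} (r : ℝ → (Fin n → ℝ)) (t : ℝ)
    (r' : Fin n → ℝ) (hr : HasDerivAt r r' t) :
    (1 / 2) * Filter.limsup
        (fun h : ℝ => (‖r (t + h)‖ ^ 2 - ‖r t‖ ^ 2) / h) (nhdsWithin 0 (Set.Ioi 0))
      = wpInf r' (r t) := by
  cases isEmpty_or_nonempty (Fin n) with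
  | inl _ =>
    have h0 (y : Fin n → ℝ) : ‖y‖ = 0 := by rw [Subsingleton.elim y 0, norm_zero]
    simp [wpInf, h0]
  | inr _ =>
    rw [(tendsto_sq_norm_slope_right r t r' hr).limsup_eq]
    ring
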